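/- Let G be a finite simple graph. If Γ' is a nonempty subfamily of MaxCritIndep(G) and Γ is a nonempty subfamily of Ω(G), then |⋂Γ'| + |⋃Γ'| ≤ 2α'(G) ≤ 2α(G) ≤ |⋂Γ| + |⋃Γ|. -/

import Mathlib

/-- `S` is an independent set in `G`: no two of its vertices are adjacent. -/
def IndepSet {V : Type*} (G : SimpleGraph V) (S : Set V) : Prop :=
  ∀ ⦃u⦄, u ∈ S → ∀ ⦃v⦄, v ∈ S → ¬G.Adj u v

/-- The independence number `α(G)`. -/
noncomputable def indNum {V : Type*} (G : SimpleGraph V) : ℕ :=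
  sSup {n : ℕ | ∃ S : Set V, IndepSet G S ∧ S.ncard = n}

/-- `Ω(G)`: the family of maximum independent sets of `G`. -/
def maxIndepFam {V : Type*} (G : SimpleGraph V) : Set (Set V) :=
  {S | IndepSet G S ∧ S.ncard = indNum G}

/-- `N(X)`: the neighborhood of a set of vertices. -/
def nbhd {V : Type*} (G : SimpleGraph V) (X : Set V) : Set V :=
  {v | ∃ x ∈ X, G.Adj v x}

/-- `N[X] = N(X) ∪ X`: the closed neighborhood of a set of vertices. -/
def closedNbhd {V : Type*} (G : SimpleGraph V) (X : Set V) : Set V :=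
  nbhd G X ∪ X

/-- The difference `d(X) = |X| - |N(X)|`. -/
noncomputable def diffd {V : Type*} (G : SimpleGraph V) (X : Set V) : ℤ :=
  (X.ncard : ℤ) - ((nbhd G X).ncard : ℤ)

/-- The critical difference `d(G) = max {d(X) : X ⊆ V(G)}`. -/
noncomputable def critDiff {V : Type*} (G : SimpleGraph V) : ℤ :=
  sSup {d : ℤ | ∃ X : Set V, diffd G X = d}

/-- `X` is a critical set if `d(X) = d(G)`. -/
def IsCritical {V : Type*} (G : SimpleGraph V) (X : Set V) : Prop :=
  diffd G X = critDiff G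

/-- `MaxCritIndep(G)`: the family of critical independent sets of maximum cardinality. -/
def maxCritIndepFam {V : Type*} (G : SimpleGraph V) : Set (Set V) :=
  {S | IndepSet G S ∧ IsCritical G S ∧
    ∀ T : Set V, IndepSet G T → IsCritical G T → T.ncard ≤ S.ncard}

/-- The critical independence number `α'(G)`. -/
noncomputable def critIndNum {V : Type*} (G : SimpleGraph V) : ℕ :=
  sSup {n : ℕ | ∃ S : Set V, IndepSet G S ∧ IsCritical G S ∧ S.ncard = n}

/-- `ker(G)`: the intersection of all critical independent sets. -/
def kerSet {V : Type*} (G : SimpleGraph V) : Set V :=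
  ⋂₀ {A : Set V | IndepSet G A ∧ IsCritical G A}

/-- `nucleus(G)`: the intersection of all maximum critical independent sets. -/
def nucleus {V : Type*} (G : SimpleGraph V) : Set V :=
  ⋂₀ maxCritIndepFam G

/-- `diadem(G)`: the union of all maximum critical independent sets. -/
def diadem {V : Type*} (G : SimpleGraph V) : Set V :=
  ⋃₀ maxCritIndepFam G

/-- `core(G)`: the intersection of all maximum independent sets. -/
def coreSet {V : Type*} (G : SimpleGraph V) : Set V :=
  ⋂₀ maxIndepFam G

/-- `corona(G)`: the union of all maximum independent sets. -/
def coronaSet {V : Type*} (G : SimpleGraph V) : Set V :=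
  ⋃₀ maxIndepFam G

/-- A matching in `G`: a set of pairwise non-incident edges of `G`. -/
def IsMatchingSet {V : Type*} (G : SimpleGraph V) (M : Set (Sym2 V)) : Prop :=
  M ⊆ G.edgeSet ∧ M.Pairwise fun e f => ∀ v, v ∈ e → v ∉ f

/-- The matching number `μ(G)`. -/
noncomputable def matchNum {V : Type*} (G : SimpleGraph V) : ℕ :=
  sSup {n : ℕ | ∃ M : Set (Sym2 V), IsMatchingSet G M ∧ M.ncard = n}

/-- `G` is a König-Egerváry graph if `α(G) + μ(G) = |V(G)|`. -/
def IsKonigEgervary {V : Type*} (G : SimpleGraph V) : Prop :=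
  indNum G + matchNum G = Nat.card V

/-- `Γ` is a König-Egerváry collection: a family of independent sets with
`|⋂Γ| + |⋃Γ| = 2α(G)`. -/
def IsKECollection {V : Type*} (G : SimpleGraph V) (Γ : Set (Set V)) : Prop :=
  (∀ S ∈ Γ, IndepSet G S) ∧ (⋂₀ Γ).ncard + (⋃₀ Γ).ncard = 2 * indNum G

lemma IndepSet.ncard_le_indNum {V : Type*} [Finite V] {G : SimpleGraph V} {S : Set V}
    (hS : IndepSet G S) : S.ncard ≤ indNum G := by
  refine le_csSup ⟨Nat.card V, ?_⟩ ⟨S, hS, rfl⟩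
  rintro n ⟨T, -, rfl⟩
  exact Set.ncard_le_card T

lemma diffd_le_critDiff {V : Type*} [Finite V] (G : SimpleGraph V) (X : Set V) :
    diffd G X ≤ critDiff G :=
  le_csSup (Set.finite_range (diffd G)).bddAbove ⟨X, rfl⟩

lemma critIndNum_eq_ncard {V : Type*} {G : SimpleGraph V} {S : Set V}
    (hS : S ∈ maxCritIndepFam G) : critIndNum G = S.ncard := by
  refine IsGreatest.csSup_eq ⟨⟨S, hS.1, hS.2.1, rfl⟩, ?_⟩
  rintro n ⟨T, hT, hTc, rfl⟩
  exact hS.2.2 T hT hTc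

lemma nbhd_mono {V : Type*} (G : SimpleGraph V) {X Y : Set V} (h : X ⊆ Y) :
    nbhd G X ⊆ nbhd G Y := fun _ ⟨x, hx, hv⟩ => ⟨x, h hx, hv⟩

lemma nbhd_union {V : Type*} (G : SimpleGraph V) (X Y : Set V) :
    nbhd G (X ∪ Y) = nbhd G X ∪ nbhd G Y := by
  ext v
  simp only [nbhd, Set.mem_union, Set.mem_ofPred_eq]
  grind

lemma IndepSet.disjoint_nbhd {V : Type*} {G : SimpleGraph V} {S : Set V} (hS : IndepSet G S) :
    Disjoint S (nbhd G S) :=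
  Set.disjoint_left.2 fun _ hv ⟨_, hx, hvx⟩ => hS hv hx hvx

/-- The difference function is supermodular. -/
lemma diffd_add_diffd_le {V : Type*} [Finite V] (G : SimpleGraph V) (X Y : Set V) :
    diffd G X + diffd G Y ≤ diffd G (X ∪ Y) + diffd G (X ∩ Y) := by
  have h1 := Set.ncard_union_add_ncard_inter X Y
  have h2 := Set.ncard_union_add_ncard_inter (nbhd G X) (nbhd G Y)
  have h3 : (nbhd G (X ∩ Y)).ncard ≤ (nbhd G X ∩ nbhd G Y).ncard :=
    Set.ncard_le_ncard (Set.subset_inter (nbhd_mono G Set.inter_subset_left)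
      (nbhd_mono G Set.inter_subset_right))
  simp only [diffd, nbhd_union]
  lia

lemma IsCritical.union {V : Type*} [Finite V] {G : SimpleGraph V} {X Y : Set V}
    (hX : IsCritical G X) (hY : IsCritical G Y) : IsCritical G (X ∪ Y) := by
  have h1 := diffd_add_diffd_le G X Y
  have h2 := diffd_le_critDiff G (X ∪ Y)
  have h3 := diffd_le_critDiff G (X ∩ Y)
  simp only [IsCritical] at *
  lia

lemma IsCritical.ncard_inter_nbhd_le {V : Type*} [Finite V] {G : SimpleGraph V} {S : Set V}
    (hS : IsCritical G S) (T : Set V) :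
    (T ∩ nbhd G S).ncard ≤ (S ∩ nbhd G T).ncard := by
  have h1 := diffd_le_critDiff G (S \ nbhd G T)
  have h2 : nbhd G (S \ nbhd G T) ⊆ nbhd G S \ T := by
    rintro v ⟨x, ⟨hxS, hxT⟩, hvx⟩
    exact ⟨⟨x, hxS, hvx⟩, fun hv => hxT ⟨v, hv, hvx.symm⟩⟩
  have h3 := Set.ncard_le_ncard h2
  have h4 := Set.ncard_inter_add_ncard_sdiff_eq_ncard S (nbhd G T)
  have h5 := Set.ncard_inter_add_ncard_sdiff_eq_ncard (nbhd G S) T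
  rw [Set.inter_comm] at h5
  simp only [IsCritical, diffd] at *
  lia

/-- All maximum critical independent sets have the same closed neighborhood. -/
lemma closedNbhd_subset_of_mem_maxCritIndepFam {V : Type*} [Finite V] {G : SimpleGraph V}
    {S T : Set V} (hS : S ∈ maxCritIndepFam G) (hT : T ∈ maxCritIndepFam G) :
    closedNbhd G T ⊆ closedNbhd G S := by
  obtain ⟨hSi, hSc, hSm⟩ := hS
  obtain ⟨hTi, hTc, -⟩ := hT
  have hdS := Set.disjoint_left.1 hSi.disjoint_nbhd
  have hAB : (T ∩ nbhd G S).ncard = (S ∩ nbhd G T).ncard :=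
    le_antisymm (hSc.ncard_inter_nbhd_le T) (hTc.ncard_inter_nbhd_le S)
  have hU := hSc.union hTc
  have hNB : S ∩ nbhd G T ⊆ nbhd G (S ∪ T) := by
    rw [nbhd_union]
    exact fun v hv => Or.inr hv.2
  have hAU : T ∩ nbhd G S ⊆ S ∪ T := fun v hv => Or.inr hv.1
  have hci : IndepSet G ((S ∪ T) \ (T ∩ nbhd G S)) := by
    rintro u ⟨hu | hu, hu'⟩ v ⟨hv | hv, hv'⟩ huv
    · exact hSi hu hv huv
    · exact hv' ⟨hv, u, hu, huv.symm⟩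
    · exact hu' ⟨hu, v, hv, huv⟩
    · exact hTi hu hv huv
  have hN : nbhd G ((S ∪ T) \ (T ∩ nbhd G S)) ⊆ nbhd G (S ∪ T) \ (S ∩ nbhd G T) := by
    refine fun v hv => ⟨nbhd_mono G Set.sdiff_subset hv, fun hvB => ?_⟩
    obtain ⟨x, ⟨hx | hx, hx'⟩, hvx⟩ := hv
    · exact hSi hvB.1 hx hvx
    · exact hx' ⟨hx, v, hvB.1, hvx.symm⟩
  have h1 := Set.ncard_le_ncard hN
  have h2 := Set.ncard_sdiff_add_ncard_of_subset hNB
  have h3 := Set.ncard_sdiff_add_ncard_of_subset hAU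
  have hcc : IsCritical G ((S ∪ T) \ (T ∩ nbhd G S)) := by
    have h4 := diffd_le_critDiff G ((S ∪ T) \ (T ∩ nbhd G S))
    simp only [IsCritical, diffd] at *
    lia
  have hSsub : S ⊆ (S ∪ T) \ (T ∩ nbhd G S) := fun v hv => ⟨Or.inl hv, fun h => hdS hv h.2⟩
  have hle := hSm _ hci hcc
  have hSeq := Set.eq_of_subset_of_ncard_le hSsub hle
  have hNsub : nbhd G S ∪ (S ∩ nbhd G T) ⊆ nbhd G (S ∪ T) :=
    Set.union_subset (nbhd_mono G Set.subset_union_left) hNB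
  have hdisj : Disjoint (nbhd G S) (S ∩ nbhd G T) :=
    hSi.disjoint_nbhd.symm.mono_right Set.inter_subset_left
  have h5 := Set.ncard_union_eq hdisj
  rw [← hSeq] at h3
  have hNeq : nbhd G S ∪ (S ∩ nbhd G T) = nbhd G (S ∪ T) := by
    refine Set.eq_of_subset_of_ncard_le hNsub ?_
    simp only [IsCritical, diffd] at hSc hU
    lia
  rintro v (hv | hv)
  · have : v ∈ nbhd G S ∪ (S ∩ nbhd G T) := hNeq ▸ nbhd_mono G Set.subset_union_right hv
    exact this.imp id And.left
  · by_cases hvS : v ∈ nbhd G S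
    · exact Or.inl hvS
    · exact Or.inr (hSeq ▸ ⟨Or.inr hv, fun h => hvS h.2⟩)

lemma ncard_sInter_add_ncard_sUnion_le {V : Type*} [Finite V] {G : SimpleGraph V}
    {Γ : Set (Set V)} (hne : Γ.Nonempty) (hΓ : Γ ⊆ maxCritIndepFam G) :
    (⋂₀ Γ).ncard + (⋃₀ Γ).ncard ≤ 2 * critIndNum G := by
  obtain ⟨S, hS⟩ := hne
  have hSm := hΓ hS
  have hsub : ⋂₀ Γ ∪ nbhd G (⋃₀ Γ) ⊆ closedNbhd G S := by
    rintro v (hv | ⟨x, ⟨T, hT, hx⟩, hvx⟩)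
    · exact Or.inr (hv S hS)
    · exact closedNbhd_subset_of_mem_maxCritIndepFam hSm (hΓ hT) (Or.inl ⟨x, hx, hvx⟩)
  have hdisj : Disjoint (⋂₀ Γ) (nbhd G (⋃₀ Γ)) := by
    refine Set.disjoint_left.2 fun v hv ⟨x, ⟨T, hT, hx⟩, hvx⟩ => ?_
    exact (hΓ hT).1 (hv T hT) hx hvx
  have h1 := Set.ncard_le_ncard hsub
  rw [Set.ncard_union_eq hdisj, closedNbhd, Set.ncard_union_eq hSm.1.disjoint_nbhd.symm] at h1
  have h2 := diffd_le_critDiff G (⋃₀ Γ)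
  have h3 := hSm.2.1
  rw [critIndNum_eq_ncard hSm]
  simp only [IsCritical, diffd] at h2 h3
  lia

lemma two_mul_indNum_le {V : Type*} [Finite V] {G : SimpleGraph V}
    {Γ : Set (Set V)} (hne : Γ.Nonempty) (hΓ : Γ ⊆ maxIndepFam G) :
    2 * indNum G ≤ (⋂₀ Γ).ncard + (⋃₀ Γ).ncard := by
  induction Γ, Γ.toFinite using Set.Finite.induction_on with
  | empty => simp at hne
  | @insert T Δ _ _ ih =>
    obtain ⟨hTΩ, hΔ⟩ := Set.insert_subset_iff.1 hΓ
    rcases Δ.eq_empty_or_nonempty with rfl | hΔne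
    · have := hTΩ.2
      simp
      lia
    · have hind : IndepSet G ((T ∩ ⋃₀ Δ) ∪ (⋂₀ Δ \ T)) := by
        obtain ⟨R, hR⟩ := hΔne
        rintro u (⟨hu, A, hA, huA⟩ | ⟨hu, -⟩) v (⟨hv, B, hB, hvB⟩ | ⟨hv, -⟩)
        · exact hTΩ.1 hu hv
        · exact (hΔ hA).1 huA (hv A hA)
        · exact (hΔ hB).1 (hu B hB) hvB
        · exact (hΔ hR).1 (hu R hR) (hv R hR)
      have h1 := hind.ncard_le_indNum
      rw [Set.ncard_union_eq (Set.disjoint_sdiff_right.mono_left Set.inter_subset_left)] at h1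
      have h2 := Set.ncard_inter_add_ncard_sdiff_eq_ncard (⋂₀ Δ) T
      have h3 := Set.ncard_union_add_ncard_inter T (⋃₀ Δ)
      have h4 := ih hΔne hΔ
      have h5 := hTΩ.2
      rw [Set.sInter_insert, Set.sUnion_insert, Set.inter_comm T (⋂₀ Δ)]
      lia

/-- For nonempty `Γ' ⊆ MaxCritIndep(G)` and nonempty `Γ ⊆ Ω(G)`,
`|⋂Γ'| + |⋃Γ'| ≤ 2α'(G) ≤ 2α(G) ≤ |⋂Γ| + |⋃Γ|`. -/
theorem stmt2 {V : Type*} [Fintype V] (G : SimpleGraph V)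
    (Γ' Γ : Set (Set V)) (hne' : Γ'.Nonempty) (hΓ' : Γ' ⊆ maxCritIndepFam G)
    (hne : Γ.Nonempty) (hΓ : Γ ⊆ maxIndepFam G) :
    (⋂₀ Γ').ncard + (⋃₀ Γ').ncard ≤ 2 * critIndNum G ∧
    2 * critIndNum G ≤ 2 * indNum G ∧
    2 * indNum G ≤ (⋂₀ Γ).ncard + (⋃₀ Γ).ncard := by
  obtain ⟨S, hS⟩ := hne'
  refine ⟨ncard_sInter_add_ncard_sUnion_le ⟨S, hS⟩ hΓ', ?_, two_mul_indNum_le hne hΓ⟩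
  rw [critIndNum_eq_ncard (hΓ' hS)]
  exact Nat.mul_le_mul_left 2 (hΓ' hS).1.ncard_le_indNum
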